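/- Let a ∈ ℤ with 3 ∣ a and a > 9, let α = 2a/3 + 1, and let f ∈ O_k[s,t] be a binary form of degree 2a. Consider the surface X : x₀² − x₁² = f(s,t)x₂² in F₁(0,0,a), with standard height H* associated to −K_X + αF, namely H*(s,t;x) = ∏_v ( max(|s|_v,|t|_v)^{3−a/3} · max(|x₀|_v, |x₁|_v, max(|s|_v,|t|_v)^a·|x₂|_v) )^{m_v}. Let C ⊂ X be the curve x₀ + x₁ = x₂ = 0. Then for every B > 0 the set {P ∈ C(k) : H*(P) ≤ B} is infinite; that is, the Northcott property fails for H* on C. -/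

import Mathlib

/-!
Statement 15 (Example 3.3 / `exa:Northcott` of Frei–Loughran): failure of the
Northcott property on the curve `C : x₀ + x₁ = x₂ = 0` of the surface
`X : x₀² - x₁² = f(s,t)x₂²` in `F₁(0,0,a)`, for the height associated to
`-K_X + (2a/3 + 1)F`, when `3 ∣ a` and `a > 9`.
-/

noncomputable section

open MvPolynomial NumberField Filter Topology IsDedekindDomain

namespace Stmt

variable (k : Type) [Field k] [NumberField k]

/-- A representative `(s,t;x₀,x₁,x₂)` of a `k`-rational point of the surface
`X : x₀² - x₁² = f(s,t)x₂²` in `F₁(0,0,a)`. -/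
structure PtRep (f : MvPolynomial (Fin 2) (𝓞 k)) : Type where
  y : Fin 2 → k
  x : Fin 3 → k
  hy : y ≠ 0
  hx : x ≠ 0
  hQ : x 0 ^ 2 - x 1 ^ 2 - (aeval y f) * x 2 ^ 2 = 0

variable {k}

/-- Two representatives give the same point of `F₁(0,0,a)(k)` iff they differ by
the `𝔾ₘ²`-action `(λ,μ)·(s,t;x) = (λs, λt; μx₀, μx₁, λ^{-a}μx₂)`. -/
def ptRel (a : ℤ) (f : MvPolynomial (Fin 2) (𝓞 k)) (P P' : PtRep k f) : Prop :=
  ∃ l m : kˣ, (∀ i, P'.y i = (l : k) * P.y i) ∧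
    P'.x 0 = (m : k) * P.x 0 ∧ P'.x 1 = (m : k) * P.x 1 ∧
    P'.x 2 = ((l ^ (-a) * m : kˣ) : k) * P.x 2

/-- `max_i |z i|_w` at an infinite place `w`. -/
def maxAt {ι : Type} [Fintype ι] [Nonempty ι] (w : InfinitePlace k) (z : ι → k) : ℝ :=
  Finset.univ.sup' Finset.univ_nonempty fun i => w (z i)

/-- The normalized absolute value `|z|_v^{m_v} = 𝔑(𝔭_v)^{-ord_v(z)}` attached to a
finite place (height-one prime) `v` of `k`. -/
def fnorm (v : HeightOneSpectrum (𝓞 k)) (z : k) : ℝ :=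
  if h : v.valuation k z = 0 then 0
  else (Ideal.absNorm v.asIdeal : ℝ) ^ (Multiplicative.toAdd (WithZero.unzero h))

/-- `max_i |z i|_v^{m_v}` at a finite place `v`. -/
def maxAtFin {ι : Type} [Fintype ι] [Nonempty ι] (v : HeightOneSpectrum (𝓞 k)) (z : ι → k) : ℝ :=
  Finset.univ.sup' Finset.univ_nonempty fun i => fnorm v (z i)

/-- The standard height associated to `-K_X + αF` for `α = 2a/3 + 1`, namely
`H*(s,t;x) = ∏_v (max(|s|_v,|t|_v)^{3-a/3} ·
  max(|x₀|_v, |x₁|_v, max(|s|_v,|t|_v)^a |x₂|_v))^{m_v}`. -/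
def Hstd (a : ℤ) (f : MvPolynomial (Fin 2) (𝓞 k)) (P : PtRep k f) : ℝ :=
  (∏ w : InfinitePlace k,
      (maxAt w P.y ^ ((3 : ℝ) - (a : ℝ) / 3) *
        max (w (P.x 0)) (max (w (P.x 1)) (maxAt w P.y ^ ((a : ℤ) : ℝ) * w (P.x 2)))) ^ w.mult) *
  ∏ᶠ v : HeightOneSpectrum (𝓞 k),
      (maxAtFin v P.y ^ ((3 : ℝ) - (a : ℝ) / 3) *
        max (fnorm v (P.x 0))
          (max (fnorm v (P.x 1)) (maxAtFin v P.y ^ ((a : ℤ) : ℝ) * fnorm v (P.x 2))))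

lemma fnorm_zero (v : HeightOneSpectrum (𝓞 k)) : fnorm v 0 = 0 := by
  simp [fnorm]

lemma fnorm_eq_one {v : HeightOneSpectrum (𝓞 k)} {z : k} (hz : v.valuation k z = 1) :
    fnorm v z = 1 := by
  have h : v.valuation k z ≠ 0 := by simp [hz]
  have hu : WithZero.unzero h = 1 := by
    rw [← WithZero.coe_inj, WithZero.coe_unzero, hz, WithZero.coe_one]
  rw [fnorm, dif_neg h, hu]
  simp

lemma fnorm_le_one {v : HeightOneSpectrum (𝓞 k)} {z : k} (hz : v.valuation k z ≤ 1) :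
    fnorm v z ≤ 1 := by
  unfold fnorm
  split_ifs with h
  · exact zero_le_one
  · have hN : 1 ≤ (Ideal.absNorm v.asIdeal : ℝ) := by
      exact_mod_cast Nat.one_le_iff_ne_zero.2 (Ideal.absNorm_eq_zero_iff.not.2 v.ne_bot)
    refine zpow_le_one_of_nonpos₀ hN ?_
    have hu : WithZero.unzero h ≤ 1 := by
      rwa [← WithZero.coe_le_coe, WithZero.coe_unzero, WithZero.coe_one]
    exact hu

/-- The point `(n : 1; 1 : -1 : 0)` of the curve `x₀ + x₁ = x₂ = 0`. -/
def curvePoint (f : MvPolynomial (Fin 2) (𝓞 k)) (n : ℕ) : PtRep k f where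
  y := ![n, 1]
  x := ![1, -1, 0]
  hy h := by simpa using congrFun h 1
  hx h := by simpa using congrFun h 0
  hQ := by simp

lemma maxAt_natCast_one (w : InfinitePlace k) {n : ℕ} (hn : 1 ≤ n) :
    maxAt w ![(n : k), 1] = n := by
  have h1 : (1 : ℝ) ≤ n := by exact_mod_cast hn
  have hw : w (n : k) = n := by
    rw [← InfinitePlace.norm_embedding_eq, map_natCast, Complex.norm_natCast]
  apply le_antisymm
  · refine Finset.sup'_le _ _ fun i _ => ?_
    fin_cases i <;> simp [hw, h1]
  · refine (Finset.le_sup' (fun i => w (![(n : k), 1] i)) (Finset.mem_univ 0)).trans' ?_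
    simp [hw]

lemma maxAtFin_natCast_one (v : HeightOneSpectrum (𝓞 k)) (n : ℕ) :
    maxAtFin v ![(n : k), 1] = 1 := by
  have hn : v.valuation k (n : k) ≤ 1 := by
    simpa using v.valuation_le_one (K := k) (n : 𝓞 k)
  apply le_antisymm
  · refine Finset.sup'_le _ _ fun i _ => ?_
    fin_cases i
    · exact fnorm_le_one hn
    · exact (fnorm_eq_one (map_one _)).le
  · exact (Finset.le_sup' (fun i => fnorm v (![(n : k), 1] i)) (Finset.mem_univ 1)).trans'
      (fnorm_eq_one (map_one _)).ge

lemma Hstd_curvePoint (a : ℤ) (f : MvPolynomial (Fin 2) (𝓞 k)) {n : ℕ} (hn : 1 ≤ n) :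
    Hstd a f (curvePoint f n) =
      ∏ w : InfinitePlace k, ((n : ℝ) ^ ((3 : ℝ) - (a : ℝ) / 3)) ^ w.mult := by
  have h1 (v : HeightOneSpectrum (𝓞 k)) : fnorm v (1 : k) = 1 := fnorm_eq_one (map_one _)
  have h2 (v : HeightOneSpectrum (𝓞 k)) : fnorm v (-1 : k) = 1 :=
    fnorm_eq_one (by rw [Valuation.map_neg, map_one])
  have h3 (w : InfinitePlace k) : w (-1 : k) = 1 := by
    rw [← InfinitePlace.norm_embedding_eq]; simp
  simp [Hstd, curvePoint, maxAt_natCast_one _ hn, maxAtFin_natCast_one, h1, h2, h3, fnorm_zero]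

lemma tendsto_Hstd_curvePoint {a : ℤ} (ha : 9 < a) (f : MvPolynomial (Fin 2) (𝓞 k)) :
    Tendsto (fun n => Hstd a f (curvePoint f n)) atTop (𝓝 0) := by
  have ha' : (9 : ℝ) < a := by exact_mod_cast ha
  have h : Tendsto (fun n : ℕ => (n : ℝ) ^ ((3 : ℝ) - (a : ℝ) / 3)) atTop (𝓝 0) := by
    have := (tendsto_rpow_neg_atTop (y := (a : ℝ) / 3 - 3) (by linarith)).comp
      tendsto_natCast_atTop_atTop
    simpa [Function.comp_def] using this
  have hprod := tendsto_finsetProd (Finset.univ : Finset (InfinitePlace k))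
    fun w _ => h.pow w.mult
  have h0 : ∏ w : InfinitePlace k, (0 : ℝ) ^ w.mult = 0 :=
    Finset.prod_eq_zero (Finset.mem_univ (Classical.arbitrary _))
      (zero_pow InfinitePlace.mult_ne_zero)
  rw [h0] at hprod
  refine hprod.congr' ?_
  filter_upwards [eventually_ge_atTop 1] with n hn
  exact (Hstd_curvePoint a f hn).symm

lemma curvePoint_mk_injective (a : ℤ) (f : MvPolynomial (Fin 2) (𝓞 k)) :
    Function.Injective fun n => Quot.mk (ptRel a f) (curvePoint f n) := by
  let ratio : Quot (ptRel a f) → k := Quot.lift (fun P => P.y 0 / P.y 1) (by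
    rintro P P' ⟨l, m, hy, -⟩
    simp only [hy]
    exact (mul_div_mul_left _ _ l.ne_zero).symm)
  intro n n' h
  simpa [ratio, curvePoint] using congrArg ratio h

/-- Example `exa:Northcott`: the Northcott property fails for
`H*` on the curve `C : x₀ + x₁ = x₂ = 0`; for every `B > 0` the set of points of
`C(k)` with `H*(P) ≤ B` is infinite. -/
theorem statement_15
    (k : Type) [Field k] [NumberField k]
    (a : ℤ) (ha3 : 3 ∣ a) (ha : 9 < a)
    (f : MvPolynomial (Fin 2) (𝓞 k)) (hf : f.IsHomogeneous (2 * a).toNat) :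
    ∀ B : ℝ, 0 < B →
      {q : Quot (ptRel a f) | ∃ P : PtRep k f,
        P.x 0 + P.x 1 = 0 ∧ P.x 2 = 0 ∧ Hstd a f P ≤ B ∧
          Quot.mk (ptRel a f) P = q}.Infinite := by
  intro B hB
  obtain ⟨N, hN⟩ := eventually_atTop.1 ((tendsto_Hstd_curvePoint ha f).eventually_le_const hB)
  refine Set.infinite_of_injOn_mapsTo (curvePoint_mk_injective a f).injOn ?_ (Set.Ici_infinite N)
  intro n hn
  exact ⟨curvePoint f n, by simp [curvePoint], by simp [curvePoint], hN n hn, rfl⟩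

end Stmt
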